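/- Let M be an n×n Haar-distributed random orthogonal matrix and P an independent uniformly random n×n permutation matrix. Then for any fixed indices a, b, the scaled entry √n · (M P Mᵀ)_{ab} converges in distribution to a standard normal random variable as n → ∞. -/

import Mathlib

open MeasureTheory Matrix

/-- Matrices are measurable as functions to functions (pi measurable structure). -/
instance matrixMeasurableSpace (n : ℕ) : MeasurableSpace (Matrix (Fin n) (Fin n) ℝ) :=
  inferInstanceAs (MeasurableSpace ((Fin n) → (Fin n) → ℝ))

/-- `μ` is the Haar probability measure on the orthogonal group `O(n)`, viewed as a
measure on `n × n` real matrices: it is a probability measure concentrated on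
orthogonal matrices which is invariant under left and right translation by
orthogonal matrices. -/
structure IsHaarOrthogonal (n : ℕ) (μ : Measure (Matrix (Fin n) (Fin n) ℝ)) : Prop where
  isProb : IsProbabilityMeasure μ
  ae_orth : ∀ᵐ M ∂μ, M * Mᵀ = 1
  left_inv : ∀ V : Matrix (Fin n) (Fin n) ℝ, V * Vᵀ = 1 → μ.map (fun M => V * M) = μ
  right_inv : ∀ V : Matrix (Fin n) (Fin n) ℝ, V * Vᵀ = 1 → μ.map (fun M => M * V) = μ

open ProbabilityTheory

instance matrixBorelSpace (n : ℕ) : BorelSpace (Matrix (Fin n) (Fin n) ℝ) :=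
  inferInstanceAs (BorelSpace ((Fin n) → (Fin n) → ℝ))

instance matrixSecondCountable (n : ℕ) : SecondCountableTopology (Matrix (Fin n) (Fin n) ℝ) :=
  inferInstanceAs (SecondCountableTopology ((Fin n) → (Fin n) → ℝ))

/-- A conjugation invariant probability measure on orthogonal matrices of trace `τ`. -/
structure ConjInv (n : ℕ) (α : Measure (Matrix (Fin n) (Fin n) ℝ)) (τ : ℝ) : Prop where
  isProb : IsProbabilityMeasure α
  ae_orth : ∀ᵐ A ∂α, A * Aᵀ = 1
  ae_tr : ∀ᵐ A ∂α, A.trace = τ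
  inv : ∀ V : Matrix (Fin n) (Fin n) ℝ, V * Vᵀ = 1 → α.map (fun A => V * A * Vᵀ) = α

lemma orth_entry {n : ℕ} {A : Matrix (Fin n) (Fin n) ℝ} (hA : A * Aᵀ = 1) (i j : Fin n) :
    |A i j| ≤ 1 := by
  have h : A ∈ Matrix.unitaryGroup (Fin n) ℝ := by
    rw [Matrix.mem_unitaryGroup_iff]
    simpa [Matrix.star_eq_conjTranspose] using hA
  simpa using entry_norm_bound_of_unitary h i j

lemma isCompact_entries (n : ℕ) :
    IsCompact {A : Matrix (Fin n) (Fin n) ℝ | ∀ i j, |A i j| ≤ 1} := by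
  have h : IsCompact (Set.pi Set.univ fun _ : Fin n =>
      (Set.pi Set.univ fun _ : Fin n => Set.Icc (-1 : ℝ) 1)) :=
    isCompact_univ_pi fun _ => isCompact_univ_pi fun _ => isCompact_Icc
  have e : {A : Matrix (Fin n) (Fin n) ℝ | ∀ i j, |A i j| ≤ 1} =
      (Set.pi Set.univ fun _ : Fin n =>
      (Set.pi Set.univ fun _ : Fin n => Set.Icc (-1 : ℝ) 1) : Set (Fin n → Fin n → ℝ)) := by
    apply Set.ext
    intro A
    constructor
    · intro hA i _ j _
      exact abs_le.1 (hA i j)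
    · intro hA i j
      exact abs_le.2 (hA i trivial j trivial)
  rw [e]
  exact h

lemma ConjInv.bounded {n : ℕ} {α : Measure (Matrix (Fin n) (Fin n) ℝ)} {τ : ℝ}
    (h : ConjInv n α τ) {E : Type*} [NormedAddCommGroup E]
    {f : Matrix (Fin n) (Fin n) ℝ → E} (hf : Continuous f) :
    ∃ C, ∀ᵐ A ∂α, ‖f A‖ ≤ C := by
  obtain ⟨C, hC⟩ := (isCompact_entries n).exists_bound_of_continuousOn hf.continuousOn
  exact ⟨C, h.ae_orth.mono fun A hA => hC A fun i j => orth_entry hA i j⟩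

lemma ConjInv.integrable {n : ℕ} {α : Measure (Matrix (Fin n) (Fin n) ℝ)} {τ : ℝ}
    (h : ConjInv n α τ) {E : Type*} [NormedAddCommGroup E] [SecondCountableTopology E]
    {f : Matrix (Fin n) (Fin n) ℝ → E} (hf : Continuous f) : Integrable f α := by
  have := h.isProb
  obtain ⟨C, hC⟩ := h.bounded hf
  exact Integrable.of_bound hf.aestronglyMeasurable C hC

lemma ConjInv.hasDerivAt {n : ℕ} {α : Measure (Matrix (Fin n) (Fin n) ℝ)} {τ : ℝ}
    (h : ConjInv n α τ) {G G' : ℝ → Matrix (Fin n) (Fin n) ℝ → ℂ}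
    (hG : ∀ θ, Continuous (G θ)) (hG' : Continuous (Function.uncurry G'))
    (hd : ∀ θ A, HasDerivAt (fun θ => G θ A) (G' θ A) θ) (θ : ℝ) :
    HasDerivAt (fun θ => ∫ A, G θ A ∂α) (∫ A, G' θ A ∂α) θ := by
  have := h.isProb
  obtain ⟨C, hC⟩ := ((isCompact_Icc (a := θ - 1) (b := θ + 1)).prod
    (isCompact_entries n)).exists_bound_of_continuousOn hG'.continuousOn
  refine (hasDerivAt_integral_of_dominated_loc_of_deriv_le (bound := fun _ => C)
    (s := Set.Icc (θ - 1) (θ + 1)) (Icc_mem_nhds (by linarith) (by linarith))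
    (Filter.Eventually.of_forall fun θ => (hG θ).aestronglyMeasurable)
    (h.integrable (hG θ)) ?_ ?_ (integrable_const C) ?_).2
  · have : Continuous (G' θ) := hG'.comp (Continuous.prodMk_right θ)
    exact this.aestronglyMeasurable
  · exact h.ae_orth.mono fun A hA x hx => hC (x, A) ⟨hx, fun i j => orth_entry hA i j⟩
  · exact Filter.Eventually.of_forall fun A x _ => hd x A

/-- generator of a rotation -/
noncomputable def genK {n : ℕ} (a c : Fin n) : Matrix (Fin n) (Fin n) ℝ :=
  Matrix.single a c 1 - Matrix.single c a 1

lemma genK_cube {n : ℕ} {a c : Fin n} (h : a ≠ c) :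
    genK a c * genK a c * genK a c = - genK a c := by
  simp [genK, Matrix.sub_mul, Matrix.mul_sub, Matrix.single_mul_single_of_ne, h, h.symm]
  abel

lemma genK_transpose {n : ℕ} (a c : Fin n) : (genK a c)ᵀ = - genK a c := by
  simp [genK]

/-- rotation -/
noncomputable def rotV {n : ℕ} (a c : Fin n) (θ : ℝ) : Matrix (Fin n) (Fin n) ℝ :=
  1 + Real.sin θ • genK a c + (1 - Real.cos θ) • (genK a c * genK a c)

lemma rotV_transpose {n : ℕ} (a c : Fin n) (θ : ℝ) : (rotV a c θ)ᵀ =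
    1 - Real.sin θ • genK a c + (1 - Real.cos θ) • (genK a c * genK a c) := by
  simp [rotV, genK_transpose]
  abel

lemma rotV_orth {n : ℕ} {a c : Fin n} (h : a ≠ c) (θ : ℝ) :
    rotV a c θ * (rotV a c θ)ᵀ = 1 := by
  have h3 := genK_cube h
  rw [rotV_transpose, rotV]
  set K := genK a c
  have h4 : K * (K * K) = - K := by rw [← Matrix.mul_assoc, h3]
  have h5 : (K * K) * (K * K) = - (K * K) := by rw [← Matrix.mul_assoc, h3]; simp
  have hs : Real.sin θ ^ 2 = 1 - Real.cos θ ^ 2 := by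
    linarith [Real.sin_sq_add_cos_sq θ]
  simp only [Matrix.add_mul, Matrix.mul_add, Matrix.mul_sub, Matrix.smul_mul,
    Matrix.mul_smul, h3, h4, h5, Matrix.one_mul, Matrix.mul_one]
  generalize K * K = L
  ext i j
  simp
  linear_combination (-L i j) * hs

lemma rotV_deriv {n : ℕ} {a c : Fin n} (h : a ≠ c) (θ : ℝ) (i j : Fin n) :
    HasDerivAt (fun θ => rotV a c θ i j) ((genK a c * rotV a c θ) i j) θ := by
  have h3 := genK_cube h
  have e : genK a c * rotV a c θ =
      Real.cos θ • genK a c + Real.sin θ • (genK a c * genK a c) := by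
    rw [rotV]
    simp only [Matrix.mul_add, Matrix.mul_smul, ← Matrix.mul_assoc, h3, Matrix.mul_one]
    ext i j
    simp
    ring
  rw [e]
  simp only [rotV, Matrix.add_apply, Matrix.smul_apply, smul_eq_mul]
  have h1 := ((Real.hasDerivAt_sin θ).mul_const (genK a c i j)).const_add
    ((1 : Matrix (Fin n) (Fin n) ℝ) i j)
  have h2 := ((Real.hasDerivAt_cos θ).const_sub 1).mul_const ((genK a c * genK a c) i j)
  simpa using h1.fun_add h2

lemma rotV_zero {n : ℕ} (a c : Fin n) : rotV a c 0 = 1 := by simp [rotV]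

/-- the conjugated matrix -/
noncomputable def conjA {n : ℕ} (a c : Fin n) (θ : ℝ) (A : Matrix (Fin n) (Fin n) ℝ) :
    Matrix (Fin n) (Fin n) ℝ := rotV a c θ * A * (rotV a c θ)ᵀ

lemma continuous_rotV {n : ℕ} (a c : Fin n) : Continuous (rotV a c) := by
  unfold rotV; fun_prop

lemma continuous_conjA {n : ℕ} (a c : Fin n) :
    Continuous (fun p : ℝ × Matrix (Fin n) (Fin n) ℝ => conjA a c p.1 p.2) := by
  unfold conjA
  have h1 : Continuous (fun p : ℝ × Matrix (Fin n) (Fin n) ℝ => rotV a c p.1) :=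
    (continuous_rotV a c).comp continuous_fst
  exact (h1.matrix_mul continuous_snd).matrix_mul h1.matrix_transpose

lemma continuous_conjA_right {n : ℕ} (a c : Fin n) (θ : ℝ) :
    Continuous (fun A : Matrix (Fin n) (Fin n) ℝ => conjA a c θ A) := by
  unfold conjA
  exact (continuous_const.matrix_mul continuous_id).matrix_mul continuous_const

lemma conjA_deriv {n : ℕ} {a c : Fin n} (h : a ≠ c) (θ : ℝ) (A : Matrix (Fin n) (Fin n) ℝ)
    (i j : Fin n) :
    HasDerivAt (fun θ => conjA a c θ A i j)
      ((genK a c * conjA a c θ A - conjA a c θ A * genK a c) i j) θ := by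
  have key : ∀ V W : Matrix (Fin n) (Fin n) ℝ, ∀ i j, (V * A * Wᵀ) i j =
      ∑ k, ∑ l, V i l * A l k * W j k := by
    intro V W i j
    simp [Matrix.mul_apply, Finset.sum_mul]
  have e : (genK a c * conjA a c θ A - conjA a c θ A * genK a c) =
      (genK a c * rotV a c θ) * A * (rotV a c θ)ᵀ + rotV a c θ * A * (genK a c * rotV a c θ)ᵀ := by
    rw [Matrix.transpose_mul, genK_transpose, conjA]
    simp [Matrix.mul_assoc, sub_eq_add_neg]
  have e2 : (genK a c * conjA a c θ A - conjA a c θ A * genK a c) i j =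
      ∑ k, ∑ l, ((genK a c * rotV a c θ) i l * A l k * rotV a c θ j k +
        rotV a c θ i l * A l k * (genK a c * rotV a c θ) j k) := by
    rw [e, Matrix.add_apply, key, key]
    simp only [Finset.sum_add_distrib]
  rw [e2]
  simp only [conjA, key]
  refine HasDerivAt.fun_sum fun k _ => HasDerivAt.fun_sum fun l _ => ?_
  exact ((rotV_deriv h θ i l).mul_const (A l k)).mul (rotV_deriv h θ j k)

/-- integration by parts on the orthogonal group -/
lemma ConjInv.ibp {n : ℕ} {α : Measure (Matrix (Fin n) (Fin n) ℝ)} {τ : ℝ}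
    (h : ConjInv n α τ) {a c : Fin n} (hac : a ≠ c) (x y z w : Fin n) {H H' : ℝ → ℂ}
    (hH : ∀ u, HasDerivAt H (H' u) u) (hH' : Continuous H') :
    ∫ A, (((genK a c * A - A * genK a c) x y : ℂ) * H (A z w) +
      (A x y : ℂ) * (((genK a c * A - A * genK a c) z w : ℂ) * H' (A z w))) ∂α = 0 := by
  have cH : Continuous H := continuous_iff_continuousAt.2 fun u => (hH u).continuousAt
  have cc := continuous_conjA a c
  have cG0 : Continuous fun A : Matrix (Fin n) (Fin n) ℝ => ((A x y : ℝ) : ℂ) * H (A z w) :=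
    (Complex.continuous_ofReal.comp (continuous_id.matrix_elem x y)).mul
      (cH.comp (continuous_id.matrix_elem z w))
  have cV : ∀ θ, Continuous (fun A => conjA a c θ A) := continuous_conjA_right a c
  have hD := h.hasDerivAt (θ := 0)
    (G := fun θ A => ((conjA a c θ A x y : ℝ) : ℂ) * H (conjA a c θ A z w))
    (G' := fun θ A => (((genK a c * conjA a c θ A - conjA a c θ A * genK a c) x y : ℝ) : ℂ) *
        H (conjA a c θ A z w) + ((conjA a c θ A x y : ℝ) : ℂ) *
        ((((genK a c * conjA a c θ A - conjA a c θ A * genK a c) z w : ℝ) : ℂ) *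
          H' (conjA a c θ A z w)))
    (fun θ => cG0.comp (cV θ))
    (by
      have : Continuous fun A : Matrix (Fin n) (Fin n) ℝ =>
        (((genK a c * A - A * genK a c) x y : ℝ) : ℂ) * H (A z w) +
      ((A x y : ℝ) : ℂ) * ((((genK a c * A - A * genK a c) z w : ℝ) : ℂ) * H' (A z w)) := by
        have hk : Continuous fun A : Matrix (Fin n) (Fin n) ℝ =>
          (genK a c * A - A * genK a c) :=
            (continuous_const.matrix_mul continuous_id).sub
              (continuous_id.matrix_mul continuous_const)
        have hk1 := Complex.continuous_ofReal.comp (hk.matrix_elem x y)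
        have hk2 := Complex.continuous_ofReal.comp (hk.matrix_elem z w)
        have hk3 := Complex.continuous_ofReal.comp
          ((continuous_id (X := Matrix (Fin n) (Fin n) ℝ)).matrix_elem x y)
        have hk4 := (continuous_id (X := Matrix (Fin n) (Fin n) ℝ)).matrix_elem z w
        exact (hk1.mul (cH.comp hk4)).add (hk3.mul (hk2.mul (hH'.comp hk4)))
      exact this.comp cc)
    (by
      intro θ A
      have h1 := (conjA_deriv hac θ A x y).ofReal_comp
      have h2 : HasDerivAt (fun θ => H (conjA a c θ A z w)) _ θ :=
        (hH _).scomp θ (conjA_deriv hac θ A z w)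
      simpa using h1.fun_mul h2)
  have hconst : (fun θ => ∫ A, ((conjA a c θ A x y : ℝ) : ℂ) * H (conjA a c θ A z w) ∂α) =
      fun _ => ∫ A, ((A x y : ℝ) : ℂ) * H (A z w) ∂α := by
    funext θ
    conv_rhs => rw [← h.inv _ (rotV_orth hac θ)]
    rw [integral_map]
    · rfl
    · exact (cV θ).measurable.aemeasurable
    · exact cG0.aestronglyMeasurable
  rw [hconst] at hD
  have := hD.unique (hasDerivAt_const _ _)
  simpa [conjA, rotV_zero] using this

lemma genK_mul_apply {n : ℕ} (a c x y : Fin n) (A : Matrix (Fin n) (Fin n) ℝ) :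
    (genK a c * A) x y = (if x = a then A c y else 0) - (if x = c then A a y else 0) := by
  simp [genK, Matrix.mul_apply, sub_mul, Matrix.single_apply, ite_and, eq_comm]

lemma mul_genK_apply {n : ℕ} (a c x y : Fin n) (A : Matrix (Fin n) (Fin n) ℝ) :
    (A * genK a c) x y = (if y = c then A x a else 0) - (if y = a then A x c else 0) := by
  simp [genK, Matrix.mul_apply, mul_sub, Matrix.single_apply, ite_and, eq_comm]

lemma continuous_entryC {n : ℕ} (a b : Fin n) :
    Continuous (fun A : Matrix (Fin n) (Fin n) ℝ => ((A a b : ℝ) : ℂ)) :=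
  Complex.continuous_ofReal.comp (continuous_id.matrix_elem a b)

lemma continuous_entry {n : ℕ} (a b : Fin n) :
    Continuous (fun A : Matrix (Fin n) (Fin n) ℝ => A a b) :=
  continuous_id.matrix_elem a b

lemma continuous_sq_entry {n : ℕ} (a b : Fin n) :
    Continuous (fun A : Matrix (Fin n) (Fin n) ℝ => (A * A) a b) :=
  (continuous_id.matrix_mul continuous_id).matrix_elem a b

lemma orth_col {n : ℕ} {A : Matrix (Fin n) (Fin n) ℝ} (hA : A * Aᵀ = 1) (b : Fin n) :
    ∑ c, A c b ^ 2 = 1 := by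
  have h1 : Aᵀ * A = 1 := mul_eq_one_comm.1 hA
  have h2 := congrFun (congrFun h1 b) b
  simpa [Matrix.mul_apply, sq] using h2

lemma ConjInv.offdiag {n : ℕ} {α : Measure (Matrix (Fin n) (Fin n) ℝ)} {τ : ℝ}
    (h : ConjInv n α τ) {a b : Fin n} (hab : a ≠ b) {H H' : ℝ → ℂ}
    (hH : ∀ u, HasDerivAt H (H' u) u) (hH' : Continuous H') :
    ∫ A, (-((n : ℂ) - 2) * ((A a b : ℝ) : ℂ) * H (A a b) +
      (1 - ((A a b : ℝ) : ℂ) ^ 2 - ((A b b : ℝ) : ℂ) ^ 2) * H' (A a b)) ∂α = 0 := by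
  have cH : Continuous H := continuous_iff_continuousAt.2 fun u => (hH u).continuousAt
  have hc : ∀ c ∈ (Finset.univ.erase a).erase b, ∫ A, (-((A a b : ℝ) : ℂ) * H (A a b) +
      ((A c b : ℝ) : ℂ) ^ 2 * H' (A a b)) ∂α = 0 := by
    intro c hc
    simp only [Finset.mem_erase, Finset.mem_univ, and_true] at hc
    have := h.ibp (Ne.symm hc.2) c b a b hH hH'
    rw [← this]
    congr 1
    funext A
    simp [genK_mul_apply, mul_genK_apply, hc.2, hc.1.symm, hc.2.symm, hab.symm]
    ring
  have hs := Finset.sum_eq_zero hc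
  rw [← integral_finsetSum] at hs
  · rw [← hs]
    apply integral_congr_ae
    filter_upwards [h.ae_orth] with A hA
    have h1 := orth_col hA b
    have hb : b ∈ Finset.univ.erase a := by simp [hab.symm]
    have hcard : (((Finset.univ.erase a).erase b).card : ℂ) = (n : ℂ) - 2 := by
      have e1 := Finset.card_erase_add_one hb
      have e2 := Finset.card_erase_add_one (Finset.mem_univ a)
      have : ((Finset.univ.erase a).erase b).card + 2 = n := by
        rw [← add_assoc _ 1 1, e1, e2]; simp
      rw [eq_sub_iff_add_eq]
      exact_mod_cast this
    have h2 : ∑ c ∈ (Finset.univ.erase a).erase b, A c b ^ 2 = 1 - A a b ^ 2 - A b b ^ 2 := by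
      have e1 := Finset.sum_erase_add _ (fun c => A c b ^ 2) hb
      have e2 := Finset.sum_erase_add _ (fun c => A c b ^ 2) (Finset.mem_univ a)
      linarith
    have h3 : ∑ c ∈ (Finset.univ.erase a).erase b, ((A c b : ℝ) : ℂ) ^ 2 =
        1 - ((A a b : ℝ) : ℂ) ^ 2 - ((A b b : ℝ) : ℂ) ^ 2 := by exact_mod_cast congrArg (Complex.ofReal) h2
    rw [Finset.sum_add_distrib, ← Finset.sum_mul _ _ (H' (A a b)), h3, Finset.sum_const, nsmul_eq_mul, hcard]
    ring
  · intro c _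
    apply h.integrable
    have := continuous_entryC a b
    have := continuous_entryC c b
    have := cH.comp (continuous_entry a b)
    have := hH'.comp (continuous_entry a b)
    simp only [Function.comp_def] at *
    fun_prop

lemma ConjInv.diag {n : ℕ} {α : Measure (Matrix (Fin n) (Fin n) ℝ)} {τ : ℝ}
    (h : ConjInv n α τ) (a : Fin n) {H H' : ℝ → ℂ}
    (hH : ∀ u, HasDerivAt H (H' u) u) (hH' : Continuous H') :
    ∫ A, (((τ : ℂ) - n * ((A a a : ℝ) : ℂ)) * H (A a a) +
      (1 + (((A * A) a a : ℝ) : ℂ) - 2 * ((A a a : ℝ) : ℂ) ^ 2) * H' (A a a)) ∂α = 0 := by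
  have cH : Continuous H := continuous_iff_continuousAt.2 fun u => (hH u).continuousAt
  have hc : ∀ c ∈ Finset.univ.erase a, ∫ A, ((((A c c : ℝ) : ℂ) - ((A a a : ℝ) : ℂ)) * H (A a a) +
      (((A c a : ℝ) : ℂ) ^ 2 + ((A a c * A c a : ℝ) : ℂ)) * H' (A a a)) ∂α = 0 := by
    intro c hc
    simp only [Finset.mem_erase, Finset.mem_univ, and_true] at hc
    have := h.ibp (Ne.symm hc) c a a a hH hH'
    rw [← this]
    congr 1
    funext A
    simp [genK_mul_apply, mul_genK_apply, hc, hc.symm]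
    ring
  have hs := Finset.sum_eq_zero hc
  rw [← integral_finsetSum] at hs
  · rw [← hs]
    apply integral_congr_ae
    filter_upwards [h.ae_orth, h.ae_tr] with A hA htr
    have h1 := orth_col hA a
    have h0 : ((∑ c ∈ Finset.univ.erase a, (A c c - A a a) : ℝ) : ℂ) = ((τ - n * A a a : ℝ) : ℂ) := by
      congr 1
      rw [Finset.sum_erase _ (by simp), Finset.sum_sub_distrib, ← htr]
      simp [Matrix.trace]
    have h2 : ((∑ c ∈ Finset.univ.erase a, (A c a ^ 2 + A a c * A c a) : ℝ) : ℂ) =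
        ((1 + (A * A) a a - 2 * A a a ^ 2 : ℝ) : ℂ) := by
      congr 1
      have e1 := Finset.sum_erase_add _ (fun c => A c a ^ 2 + A a c * A c a) (Finset.mem_univ a)
      simp only [Finset.sum_add_distrib, h1] at e1
      rw [Matrix.mul_apply, Finset.sum_add_distrib]
      linarith
    push_cast at h0 h2
    rw [Finset.sum_add_distrib, ← Finset.sum_mul, ← Finset.sum_mul]
    push_cast
    rw [h0, h2]
  · intro c _
    apply h.integrable
    have := continuous_entryC a a
    have := continuous_entryC a c
    have := continuous_entryC c c
    have := continuous_entryC c a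
    have := cH.comp (continuous_entry a a)
    have := hH'.comp (continuous_entry a a)
    simp only [Function.comp_def, Complex.ofReal_mul] at *
    fun_prop

lemma ConjInv.offdiag_sq {n : ℕ} {α : Measure (Matrix (Fin n) (Fin n) ℝ)} {τ : ℝ}
    (h : ConjInv n α τ) {a b : Fin n} (hab : a ≠ b) :
    ((n : ℝ) - 2) * ∫ A, A a b ^ 2 ∂α ≤ 1 := by
  have := h.isProb
  have h1 := h.offdiag hab (H := fun u : ℝ => (u : ℂ)) (H' := fun _ => 1)
    (fun u => (hasDerivAt_id u).ofReal_comp) continuous_const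
  have h2 : ∫ A, (-((n : ℝ) - 2) * A a b * A a b + (1 - A a b ^ 2 - A b b ^ 2)) ∂α = 0 := by
    have e : ((∫ A, (-((n : ℝ) - 2) * A a b * A a b + (1 - A a b ^ 2 - A b b ^ 2)) ∂α : ℝ) : ℂ) = 0 := by
      rw [← integral_complex_ofReal, ← h1]
      congr 1
      funext A
      push_cast
      ring
    exact_mod_cast e
  have c1 := continuous_entry a b
  have c2 := continuous_entry b b
  have i1 : Integrable (fun A : Matrix (Fin n) (Fin n) ℝ => A a b ^ 2) α :=
    h.integrable (by fun_prop)
  have h3 : ∫ A, (-((n : ℝ) - 2) * A a b * A a b + (1 - A a b ^ 2 - A b b ^ 2)) ∂α ≤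
      ∫ A, (1 - ((n : ℝ) - 2) * A a b ^ 2) ∂α := by
    apply integral_mono (h.integrable (by fun_prop)) (h.integrable (by fun_prop))
    intro A
    nlinarith [sq_nonneg (A a b), sq_nonneg (A b b)]
  rw [integral_sub (integrable_const _) (i1.const_mul _), integral_const_mul, h2] at h3
  simp at h3
  linarith

lemma orth_mul {n : ℕ} {A B : Matrix (Fin n) (Fin n) ℝ} (hA : A * Aᵀ = 1) (hB : B * Bᵀ = 1) :
    (A * B) * (A * B)ᵀ = 1 := by
  rw [Matrix.transpose_mul, Matrix.mul_assoc, ← Matrix.mul_assoc B, hB, Matrix.one_mul, hA]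

lemma ConjInv.diag_sq {n : ℕ} {α : Measure (Matrix (Fin n) (Fin n) ℝ)} {τ : ℝ}
    (h : ConjInv n α τ) (hτ : 0 ≤ τ) (a : Fin n) :
    (n : ℝ) * ∫ A, A a a ^ 2 ∂α ≤ τ + 2 := by
  have := h.isProb
  have h1 := h.diag a (H := fun u : ℝ => (u : ℂ)) (H' := fun _ => 1)
    (fun u => (hasDerivAt_id u).ofReal_comp) continuous_const
  have h2 : ∫ A, ((τ - n * A a a) * A a a + (1 + (A * A) a a - 2 * A a a ^ 2)) ∂α = 0 := by
    have e : ((∫ A, ((τ - n * A a a) * A a a + (1 + (A * A) a a - 2 * A a a ^ 2)) ∂α : ℝ) : ℂ) = 0 := by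
      rw [← integral_complex_ofReal, ← h1]
      congr 1
      funext A
      push_cast
      ring
    exact_mod_cast e
  have c1 := continuous_entry a a
  have c2 := continuous_sq_entry a a
  have i1 : Integrable (fun A : Matrix (Fin n) (Fin n) ℝ => A a a ^ 2) α :=
    h.integrable (by fun_prop)
  have h3 : ∫ A, ((τ - n * A a a) * A a a + (1 + (A * A) a a - 2 * A a a ^ 2)) ∂α ≤
      ∫ A, (τ + 2 - n * A a a ^ 2) ∂α := by
    apply integral_mono_ae (h.integrable (by fun_prop)) (h.integrable (by fun_prop))
    filter_upwards [h.ae_orth] with A hA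
    have b1 := (abs_le.1 (orth_entry hA a a)).2
    have b2 := (abs_le.1 (orth_entry (orth_mul hA hA) a a)).2
    nlinarith [sq_nonneg (A a a), mul_le_mul_of_nonneg_left b1 hτ]
  rw [integral_sub (integrable_const _) (i1.const_mul _), integral_const_mul, h2] at h3
  simp at h3
  linarith

lemma ode_bound {φ φ' : ℝ → ℂ} {η : ℝ} (hd : ∀ t, HasDerivAt φ (φ' t) t) (h0 : φ 0 = 1)
    (hb : ∀ t, ‖φ' t + t * φ t‖ ≤ (1 + |t|) * η) (hη : 0 ≤ η) (t : ℝ) :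
    ‖φ t - Complex.exp (-(t : ℂ) ^ 2 / 2)‖ ≤ (1 + |t|) * |t| * η := by
  have hE : ∀ u : ℝ, HasDerivAt (fun u : ℝ => Complex.exp ((u : ℂ) ^ 2 / 2))
      (Complex.exp ((u : ℂ) ^ 2 / 2) * u) u := by
    intro u
    have h1 : HasDerivAt (fun u : ℝ => (u : ℂ)) 1 u := (hasDerivAt_id u).ofReal_comp
    have h2 := ((h1.fun_pow 2).div_const 2).cexp
    convert h2 using 1
    simp
  have hn : ∀ u : ℝ, ‖Complex.exp ((u : ℂ) ^ 2 / 2)‖ = Real.exp (u ^ 2 / 2) := by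
    intro u
    rw [show (u : ℂ) ^ 2 / 2 = ((u ^ 2 / 2 : ℝ) : ℂ) by push_cast; ring, ← Complex.ofReal_exp,
      Complex.norm_real, Real.norm_of_nonneg (Real.exp_pos _).le]
  have key := Convex.norm_image_sub_le_of_norm_hasDerivWithin_le
    (f := fun u : ℝ => Complex.exp ((u : ℂ) ^ 2 / 2) * φ u)
    (f' := fun u : ℝ => Complex.exp ((u : ℂ) ^ 2 / 2) * u * φ u +
      Complex.exp ((u : ℂ) ^ 2 / 2) * φ' u)
    (s := Set.Icc (-|t|) |t|) (x := 0) (y := t)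
    (C := Real.exp (t ^ 2 / 2) * ((1 + |t|) * η))
    (fun u _ => ((hE u).fun_mul (hd u)).hasDerivWithinAt)
    (by
      intro u hu
      have hu' : |u| ≤ |t| := abs_le.2 hu
      rw [show Complex.exp ((u : ℂ) ^ 2 / 2) * u * φ u + Complex.exp ((u : ℂ) ^ 2 / 2) * φ' u =
        Complex.exp ((u : ℂ) ^ 2 / 2) * (φ' u + u * φ u) by ring, norm_mul, hn]
      have := sq_le_sq.2 hu'
      gcongr
      exact (hb u).trans (by gcongr))
    (convex_Icc _ _) (by simp) (by simp [neg_abs_le, le_abs_self])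
  simp only [Complex.ofReal_zero, h0] at key
  have e : φ t - Complex.exp (-(t : ℂ) ^ 2 / 2) = Complex.exp (-(t : ℂ) ^ 2 / 2) *
      (Complex.exp ((t : ℂ) ^ 2 / 2) * φ t - Complex.exp (0 ^ 2 / 2) * 1) := by
    rw [mul_sub, ← mul_assoc, ← Complex.exp_add]
    simp [neg_div]
  have hn2 : ‖Complex.exp (-(t : ℂ) ^ 2 / 2)‖ = Real.exp (-(t ^ 2 / 2)) := by
    rw [show -(t : ℂ) ^ 2 / 2 = ((-(t ^ 2 / 2) : ℝ) : ℂ) by push_cast; ring, ← Complex.ofReal_exp,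
      Complex.norm_real, Real.norm_of_nonneg (Real.exp_pos _).le]
  rw [e, norm_mul, hn2]
  calc _ ≤ Real.exp (-(t ^ 2 / 2)) * (Real.exp (t ^ 2 / 2) * ((1 + |t|) * η) * ‖t - 0‖) := by
        gcongr
    _ = (Real.exp (-(t ^ 2 / 2)) * Real.exp (t ^ 2 / 2)) * ((1 + |t|) * |t| * η) := by
        simp; ring
    _ = _ := by rw [← Real.exp_add]; simp

/-- the characteristic exponential of a scaled entry -/
noncomputable def eC (s t u : ℝ) : ℂ := Complex.exp (Complex.I * t * s * u)

lemma eC_norm (s t u : ℝ) : ‖eC s t u‖ = 1 := by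
  rw [eC, show Complex.I * t * s * u = ((t * s * u : ℝ) : ℂ) * Complex.I by push_cast; ring,
    Complex.norm_exp_ofReal_mul_I]

lemma eC_deriv_u (s t u : ℝ) :
    HasDerivAt (eC s t) (Complex.I * t * s * eC s t u) u := by
  have h1 : HasDerivAt (fun u : ℝ => (u : ℂ)) 1 u := (hasDerivAt_id u).ofReal_comp
  have h2 := (h1.const_mul (Complex.I * t * s)).cexp
  unfold eC
  convert h2 using 1
  ring

lemma eC_deriv_t (s t u : ℝ) :
    HasDerivAt (fun t => eC s t u) (Complex.I * s * u * eC s t u) t := by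
  have h1 : HasDerivAt (fun u : ℝ => (u : ℂ)) 1 t := (hasDerivAt_id t).ofReal_comp
  have h2 := (h1.const_mul (Complex.I * s * u)).cexp
  unfold eC
  convert h2 using 1
  · funext y
    congr 1
    ring
  · rw [show Complex.I * t * s * u = Complex.I * s * u * t by ring]
    ring

lemma continuous_eC (s : ℝ) : Continuous (fun p : ℝ × ℝ => eC s p.1 p.2) := by
  unfold eC; fun_prop

lemma ConjInv.char_deriv {n : ℕ} {α : Measure (Matrix (Fin n) (Fin n) ℝ)} {τ : ℝ}
    (h : ConjInv n α τ) (a b : Fin n) (s t : ℝ) :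
    HasDerivAt (fun t => ∫ A, eC s t (A a b) ∂α)
      (∫ A, Complex.I * s * ((A a b : ℝ) : ℂ) * eC s t (A a b) ∂α) t := by
  have c1 := continuous_entry a b
  refine h.hasDerivAt (G := fun t A => eC s t (A a b))
    (G' := fun t A => Complex.I * s * ((A a b : ℝ) : ℂ) * eC s t (A a b)) ?_ ?_ ?_ t
  · intro t
    unfold eC
    have := continuous_entryC a b
    fun_prop
  · have h1 : Continuous (fun p : ℝ × Matrix (Fin n) (Fin n) ℝ => ((p.2 a b : ℝ) : ℂ)) :=
      (continuous_entryC a b).comp continuous_snd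
    have h2 : Continuous (fun p : ℝ × Matrix (Fin n) (Fin n) ℝ => ((p.1 : ℝ) : ℂ)) :=
      Complex.continuous_ofReal.comp continuous_fst
    unfold eC Function.uncurry
    fun_prop
  · intro t A
    exact eC_deriv_t s t (A a b)

lemma ConjInv.off_bound {n : ℕ} {α : Measure (Matrix (Fin n) (Fin n) ℝ)} {τ : ℝ}
    (h : ConjInv n α τ) (hn : 4 ≤ n) (hτ : 0 ≤ τ) {a b : Fin n} (hab : a ≠ b) (t : ℝ) :
    ‖(∫ A, Complex.I * (√n : ℝ) * ((A a b : ℝ) : ℂ) * eC √n t (A a b) ∂α) +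
      t * ∫ A, eC √n t (A a b) ∂α‖ ≤ |t| * ((2 * τ + 12) / n) := by
  have := h.isProb
  set s : ℝ := √n with hs
  have hn4 : (4 : ℝ) ≤ n := by exact_mod_cast hn
  have hss : s * s = n := Real.mul_self_sqrt (by positivity)
  have hssC : (s : ℂ) * s = n := by exact_mod_cast congrArg Complex.ofReal hss
  have hn2 : (0 : ℝ) < (n : ℝ) - 2 := by linarith
  have hn2C : ((n : ℂ) - 2) ≠ 0 := by
    have := hn2.ne'
    intro h
    apply this
    exact_mod_cast h
  have c1 := continuous_entryC a b
  have c2 := continuous_entryC b b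
  have c3 : Continuous (fun A : Matrix (Fin n) (Fin n) ℝ => eC s t (A a b)) := by
    unfold eC; fun_prop
  have r1 := continuous_entry a b
  have r2 := continuous_entry b b
  have h1 := h.offdiag hab (H := eC s t) (H' := fun u => Complex.I * t * s * eC s t u)
    (eC_deriv_u s t) (by unfold eC; fun_prop)
  have e : (∫ A, Complex.I * s * ((A a b : ℝ) : ℂ) * eC s t (A a b) ∂α) +
      t * ∫ A, eC s t (A a b) ∂α =
      ∫ A, (t * (1 - n / (n - 2) * (1 - ((A a b : ℝ) : ℂ) ^ 2 - ((A b b : ℝ) : ℂ) ^ 2))) *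
        eC s t (A a b) ∂α := by
    have h2 := congrArg (fun z => (Complex.I * s / ((n : ℂ) - 2)) * z) h1
    simp only [mul_zero] at h2
    rw [← integral_const_mul] at h2 ⊢
    rw [← add_zero (_ + _), ← h2, ← integral_add, ← integral_add]
    · congr 1
      funext A
      have hdd : ((n : ℂ) - 2) * ((n : ℂ) - 2)⁻¹ = 1 := mul_inv_cancel₀ hn2C
      simp only [div_eq_mul_inv]
      generalize ((n : ℂ) - 2)⁻¹ = d at hdd ⊢
      linear_combination (-(Complex.I * s * ((A a b : ℝ) : ℂ) * eC s t (A a b))) * hdd +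
        ((1 - ((A a b : ℝ) : ℂ) ^ 2 - ((A b b : ℝ) : ℂ) ^ 2) * t * eC s t (A a b) * d) *
          (s * s * Complex.I_sq - hssC)
    all_goals exact h.integrable (by fun_prop)
  rw [e]
  have hb : ‖∫ A, (t * (1 - n / (n - 2) * (1 - ((A a b : ℝ) : ℂ) ^ 2 - ((A b b : ℝ) : ℂ) ^ 2))) *
        eC s t (A a b) ∂α‖ ≤
      ∫ A, |t| * (2 / (n - 2) + n / (n - 2) * (A a b ^ 2 + A b b ^ 2)) ∂α := by
    apply norm_integral_le_of_norm_le (h.integrable (by fun_prop))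
    refine Filter.Eventually.of_forall fun A => ?_
    rw [norm_mul, eC_norm, mul_one, norm_mul, Complex.norm_real, Real.norm_eq_abs]
    gcongr
    rw [show (1 - (n : ℂ) / (n - 2) * (1 - ((A a b : ℝ) : ℂ) ^ 2 - ((A b b : ℝ) : ℂ) ^ 2)) =
      ((1 - n / (n - 2) * (1 - A a b ^ 2 - A b b ^ 2) : ℝ) : ℂ) by push_cast; ring,
      Complex.norm_real, Real.norm_eq_abs]
    have e1 : (1 - n / (n - 2) * (1 - A a b ^ 2 - A b b ^ 2)) =
      -(2 / ((n : ℝ) - 2)) + n / (n - 2) * (A a b ^ 2 + A b b ^ 2) := by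
      field_simp
      ring
    rw [e1]
    have p1 : 0 ≤ 2 / ((n : ℝ) - 2) := by positivity
    have p2 : 0 ≤ n / ((n : ℝ) - 2) * (A a b ^ 2 + A b b ^ 2) := by positivity
    rw [abs_le]
    constructor <;> linarith
  refine hb.trans ?_
  have i1 : Integrable (fun A : Matrix (Fin n) (Fin n) ℝ => A a b ^ 2) α :=
    h.integrable (by fun_prop)
  have i2 : Integrable (fun A : Matrix (Fin n) (Fin n) ℝ => A b b ^ 2) α :=
    h.integrable (by fun_prop)
  rw [integral_const_mul, integral_add (integrable_const _) (h.integrable (by fun_prop)),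
    integral_const_mul, integral_add i1 i2]
  have q1 := h.offdiag_sq hab
  have q2 := h.diag_sq hτ b
  set x := ∫ A, A a b ^ 2 ∂α
  set y := ∫ A, A b b ^ 2 ∂α
  have q0 : 0 ≤ x := integral_nonneg fun A => sq_nonneg _
  gcongr
  simp only [integral_const, probReal_univ, smul_eq_mul, one_mul]
  have q3 : x ≤ 1 / (n - 2) := by rw [le_div_iff₀ hn2]; linarith
  have q4 : y ≤ (τ + 2) / n := by rw [le_div_iff₀ (by linarith)]; linarith
  have q5 : 1 / ((n : ℝ) - 2) ≤ 2 / n := by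
    rw [div_le_div_iff₀ hn2 (by linarith)]; linarith
  have q6 : (n : ℝ) / (n - 2) ≤ 2 := by rw [div_le_iff₀ hn2]; linarith
  calc 2 / ((n : ℝ) - 2) + n / (n - 2) * (x + y)
      ≤ 2 * (2 / n) + 2 * (2 / n + (τ + 2) / n) := by
        have : 2 / ((n : ℝ) - 2) = 2 * (1 / (n - 2)) := by ring
        rw [this]
        have hy : 0 ≤ y := integral_nonneg fun A => sq_nonneg _
        gcongr
        linarith
    _ = _ := by ring

lemma ConjInv.diag_bound {n : ℕ} {α : Measure (Matrix (Fin n) (Fin n) ℝ)} {τ τ2 : ℝ}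
    (h : ConjInv n α τ) (h2 : ConjInv n (α.map (fun A => A * A)) τ2)
    (hn : 4 ≤ n) (hτ : 0 ≤ τ) (hτ2 : 0 ≤ τ2) (a : Fin n) (t : ℝ) :
    ‖(∫ A, Complex.I * (√n : ℝ) * ((A a a : ℝ) : ℂ) * eC √n t (A a a) ∂α) +
      t * ∫ A, eC √n t (A a a) ∂α‖ ≤
      τ / √n + |t| * ((τ2 + 3) / √n + 2 * ((τ + 2) / n)) := by
  have := h.isProb
  set s : ℝ := √n with hs
  have hn4 : (4 : ℝ) ≤ n := by exact_mod_cast hn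
  have hss : s * s = n := Real.mul_self_sqrt (by positivity)
  have hs0 : 0 < s := Real.sqrt_pos.2 (by linarith)
  have hssC : (s : ℂ) * s = n := by exact_mod_cast congrArg Complex.ofReal hss
  have hsC : (s : ℂ) ≠ 0 := by exact_mod_cast hs0.ne'
  have c1 := continuous_entryC a a
  have r1 := continuous_entry a a
  have r2 := continuous_sq_entry a a
  have c2 := Complex.continuous_ofReal.comp r2
  simp only [Function.comp_def] at c2
  have c3 : Continuous (fun A : Matrix (Fin n) (Fin n) ℝ => eC s t (A a a)) := by
    unfold eC; fun_prop
  have h1 := h.diag a (H := eC s t) (H' := fun u => Complex.I * t * s * eC s t u)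
    (eC_deriv_u s t) (by unfold eC; fun_prop)
  have e : (∫ A, Complex.I * s * ((A a a : ℝ) : ℂ) * eC s t (A a a) ∂α) +
      t * ∫ A, eC s t (A a a) ∂α =
      ∫ A, (Complex.I * ((τ / s : ℝ) : ℂ) - t * (((A * A) a a - 2 * A a a ^ 2 : ℝ) : ℂ)) *
        eC s t (A a a) ∂α := by
    have h2 := congrArg (fun z => (Complex.I / s) * z) h1
    simp only [mul_zero] at h2
    rw [← integral_const_mul] at h2 ⊢
    rw [← add_zero (_ + _), ← h2, ← integral_add, ← integral_add]
    · congr 1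
      funext A
      rw [← hssC]
      push_cast
      field_simp
      linear_combination ((t : ℂ) * s *
        (1 + (((A * A) a a : ℝ) : ℂ) - 2 * ((A a a : ℝ) : ℂ) ^ 2) * eC s t (A a a)) * Complex.I_sq
    all_goals exact h.integrable (by fun_prop)
  rw [e]
  have hb : ‖∫ A, (Complex.I * ((τ / s : ℝ) : ℂ) - t * (((A * A) a a - 2 * A a a ^ 2 : ℝ) : ℂ)) *
        eC s t (A a a) ∂α‖ ≤
      ∫ A, (τ / s + |t| * (1 / s + s * (A * A) a a ^ 2 + 2 * A a a ^ 2)) ∂α := by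
    apply norm_integral_le_of_norm_le (h.integrable (by fun_prop))
    refine Filter.Eventually.of_forall fun A => ?_
    rw [norm_mul, eC_norm, mul_one]
    refine (norm_sub_le _ _).trans ?_
    rw [norm_mul, norm_mul, Complex.norm_real, Complex.norm_real, Complex.norm_real, Complex.norm_I,
      one_mul, Real.norm_of_nonneg (by positivity : 0 ≤ τ / s), Real.norm_eq_abs, Real.norm_eq_abs]
    gcongr
    refine (abs_sub _ _).trans ?_
    rw [abs_of_nonneg (by positivity : 0 ≤ 2 * A a a ^ 2)]
    gcongr
    generalize (A * A) a a = B
    have : 1 / s + s * B ^ 2 - |B| = (1 / s) * ((s * |B| - 1 / 2) ^ 2 + 3 / 4) := by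
      rw [← sq_abs B]
      field_simp
      ring
    have p : 0 ≤ (1 / s) * ((s * |B| - 1 / 2) ^ 2 + 3 / 4) := by positivity
    linarith
  refine hb.trans ?_
  have i1 : Integrable (fun A : Matrix (Fin n) (Fin n) ℝ => A a a ^ 2) α :=
    h.integrable (by fun_prop)
  have i2 : Integrable (fun A : Matrix (Fin n) (Fin n) ℝ => (A * A) a a ^ 2) α :=
    h.integrable (by fun_prop)
  have q1 := h.diag_sq hτ a
  have q2 := h2.diag_sq hτ2 a
  rw [integral_map (by
      have : Continuous (fun A : Matrix (Fin n) (Fin n) ℝ => A * A) :=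
        continuous_id.matrix_mul continuous_id
      exact this.measurable.aemeasurable)
    (by
      have : Continuous (fun A : Matrix (Fin n) (Fin n) ℝ => A a a ^ 2) := by fun_prop
      exact this.aestronglyMeasurable)] at q2
  rw [integral_add (integrable_const _) (h.integrable (by fun_prop)), integral_const_mul,
    integral_add (h.integrable (by fun_prop)) (i1.const_mul _),
    integral_add (integrable_const _) (i2.const_mul _), integral_const_mul, integral_const_mul]
  set x := ∫ A, A a a ^ 2 ∂α
  set y := ∫ A, (A * A) a a ^ 2 ∂α
  simp only [integral_const, probReal_univ, smul_eq_mul, one_mul]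
  have q3 : y ≤ (τ2 + 2) / n := by rw [le_div_iff₀ (by linarith)]; linarith
  have q4 : x ≤ (τ + 2) / n := by rw [le_div_iff₀ (by linarith)]; linarith
  have q5 : (τ2 + 3) / s = 1 / s + s * ((τ2 + 2) / n) := by
    rw [← hss]; field_simp; ring
  rw [q5]
  gcongr

lemma ConjInv.char_bound {n : ℕ} {α : Measure (Matrix (Fin n) (Fin n) ℝ)} {τ τ2 : ℝ}
    (h : ConjInv n α τ) (h2 : ConjInv n (α.map (fun A => A * A)) τ2)
    (hn : 4 ≤ n) (hτ : 0 ≤ τ) (hτ2 : 0 ≤ τ2) (a b : Fin n) (t : ℝ) :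
    ‖(∫ A, eC √n t (A a b) ∂α) - Complex.exp (-(t : ℂ) ^ 2 / 2)‖ ≤
      (1 + |t|) * |t| * ((3 * τ + τ2 + 12) / √n) := by
  have := h.isProb
  have hn4 : (4 : ℝ) ≤ n := by exact_mod_cast hn
  have hs0 : 0 < √(n : ℝ) := Real.sqrt_pos.2 (by linarith)
  have hsn : √(n : ℝ) ≤ n := by
    rw [Real.sqrt_le_left (by linarith)]
    nlinarith
  refine ode_bound (φ := fun t => ∫ A, eC √n t (A a b) ∂α)
    (fun t => h.char_deriv a b √n t) (by simp [eC]) ?_ (by positivity) t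
  intro t
  by_cases hab : a = b
  · subst hab
    refine (h.diag_bound h2 hn hτ hτ2 a t).trans ?_
    have q : (τ + 2) / n ≤ (τ + 2) / √n := by gcongr
    calc τ / √n + |t| * ((τ2 + 3) / √n + 2 * ((τ + 2) / n))
        ≤ (3 * τ + τ2 + 12) / √n + |t| * ((τ2 + 3) / √n + 2 * ((τ + 2) / √n)) := by
          gcongr
          linarith
      _ ≤ (3 * τ + τ2 + 12) / √n + |t| * ((3 * τ + τ2 + 12) / √n) := by
          have : (τ2 + 3) / √n + 2 * ((τ + 2) / √n) = (2 * τ + τ2 + 7) / √n := by ring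
          rw [this]
          gcongr <;> linarith
      _ = _ := by ring
  · refine (h.off_bound hn hτ hab t).trans ?_
    have q : (2 * τ + 12) / n ≤ (3 * τ + τ2 + 12) / √n := by
      gcongr
      linarith
    gcongr
    linarith

lemma haar_conjInv {n : ℕ} {μ : Measure (Matrix (Fin n) (Fin n) ℝ)} (hμ : IsHaarOrthogonal n μ)
    (P : Matrix (Fin n) (Fin n) ℝ) (hP : P * Pᵀ = 1) :
    ConjInv n (μ.map (fun M => M * P * Mᵀ)) P.trace := by
  have := hμ.isProb
  have c : Continuous (fun M : Matrix (Fin n) (Fin n) ℝ => M * P * Mᵀ) :=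
    (continuous_id.matrix_mul continuous_const).matrix_mul continuous_id.matrix_transpose
  have cm := c.measurable
  have hmul : Continuous (fun A : Matrix (Fin n) (Fin n) ℝ => A * Aᵀ) :=
    continuous_id.matrix_mul continuous_id.matrix_transpose
  have htr : Continuous (fun A : Matrix (Fin n) (Fin n) ℝ => A.trace) :=
    continuous_id.matrix_trace
  refine ⟨Measure.isProbabilityMeasure_map cm.aemeasurable, ?_, ?_, ?_⟩
  · rw [ae_map_iff cm.aemeasurable (isClosed_eq hmul continuous_const).measurableSet]
    filter_upwards [hμ.ae_orth] with M hM
    exact orth_mul (orth_mul hM hP) (by rw [Matrix.transpose_transpose]; exact mul_eq_one_comm.1 hM)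
  · rw [ae_map_iff cm.aemeasurable (isClosed_eq htr continuous_const).measurableSet]
    filter_upwards [hμ.ae_orth] with M hM
    rw [Matrix.trace_mul_comm, ← Matrix.mul_assoc, mul_eq_one_comm.1 hM, Matrix.one_mul]
  · intro V hV
    have c1 : Continuous (fun A : Matrix (Fin n) (Fin n) ℝ => V * A * Vᵀ) :=
      (continuous_const.matrix_mul continuous_id).matrix_mul continuous_const
    have c2 : Continuous (fun A : Matrix (Fin n) (Fin n) ℝ => V * A) :=
      (continuous_const.matrix_mul continuous_id)
    rw [Measure.map_map c1.measurable cm]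
    conv_rhs => rw [← hμ.left_inv V hV, Measure.map_map cm c2.measurable]
    congr 1
    funext M
    simp [Matrix.mul_assoc]

lemma haar_conjInv_sq {n : ℕ} {μ : Measure (Matrix (Fin n) (Fin n) ℝ)} (hμ : IsHaarOrthogonal n μ)
    (P : Matrix (Fin n) (Fin n) ℝ) (hP : P * Pᵀ = 1) :
    ConjInv n ((μ.map (fun M => M * P * Mᵀ)).map (fun A => A * A)) (P * P).trace := by
  have h := haar_conjInv hμ (P * P) (orth_mul hP hP)
  have c : Continuous (fun M : Matrix (Fin n) (Fin n) ℝ => M * P * Mᵀ) :=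
    (continuous_id.matrix_mul continuous_const).matrix_mul continuous_id.matrix_transpose
  have c2 : Continuous (fun A : Matrix (Fin n) (Fin n) ℝ => A * A) :=
    continuous_id.matrix_mul continuous_id
  rw [Measure.map_map c2.measurable c.measurable]
  convert h using 1
  apply Measure.map_congr
  filter_upwards [hμ.ae_orth] with M hM
  have := mul_eq_one_comm.1 hM
  simp only [Function.comp]
  calc M * P * Mᵀ * (M * P * Mᵀ) = M * P * (Mᵀ * M) * P * Mᵀ := by simp [Matrix.mul_assoc]
    _ = _ := by rw [this]; simp [Matrix.mul_assoc]

lemma trace_perm_eq {N : ℕ} (σ : Equiv.Perm (Fin N)) :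
    (σ.permMatrix ℝ).trace = ∑ i, if σ i = i then (1 : ℝ) else 0 := by
  simp [Matrix.trace, Equiv.toPEquiv_apply, PEquiv.toMatrix_apply, eq_comm]

lemma trace_perm_sq_eq {N : ℕ} (σ : Equiv.Perm (Fin N)) :
    (σ.permMatrix ℝ * σ.permMatrix ℝ).trace = ∑ i, if σ (σ i) = i then (1 : ℝ) else 0 := by
  rw [← Matrix.permMatrix_mul, trace_perm_eq]
  rfl

lemma perm_orth {N : ℕ} (σ : Equiv.Perm (Fin N)) :
    σ.permMatrix ℝ * (σ.permMatrix ℝ)ᵀ = 1 := by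
  rw [Matrix.transpose_permMatrix, ← Matrix.permMatrix_mul]
  simp

/-- number of permutations sending `i` to itself -/
lemma card_fix {N : ℕ} (i : Fin N) :
    N * (Finset.univ.filter fun σ : Equiv.Perm (Fin N) => σ i = i).card = N.factorial := by
  have h1 : ∀ k : Fin N, (Finset.univ.filter fun σ : Equiv.Perm (Fin N) => σ i = k).card =
      (Finset.univ.filter fun σ : Equiv.Perm (Fin N) => σ i = i).card := by
    intro k
    refine Finset.card_bij (fun σ _ => Equiv.swap i k * σ) ?_ ?_ ?_
    · intro σ hσ
      simp only [Finset.mem_filter, Finset.mem_univ, true_and] at hσ ⊢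
      simp [hσ]
    · intro σ _ σ' _ h
      exact mul_left_cancel h
    · intro σ hσ
      simp only [Finset.mem_filter, Finset.mem_univ, true_and] at hσ
      exact ⟨Equiv.swap i k * σ, by simp [hσ], by simp [← mul_assoc]⟩
  have h2 := Finset.card_eq_sum_card_fiberwise (s := (Finset.univ : Finset (Equiv.Perm (Fin N))))
    (t := Finset.univ) (f := fun σ => σ i) (fun _ _ => by simp)
  simp only [h1, Finset.sum_const, Finset.card_univ, Fintype.card_perm, Fintype.card_fin,
    smul_eq_mul] at h2
  exact h2.symm

lemma card_fix_sq {N : ℕ} (i : Fin N) :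
    (N - 2) * (Finset.univ.filter fun σ : Equiv.Perm (Fin N) => σ (σ i) = i ∧ σ i ≠ i).card ≤
      N.factorial := by
  have h1 : ∀ k ∈ Finset.univ.erase i,
      (Finset.univ.filter fun σ : Equiv.Perm (Fin N) => (σ (σ i) = i ∧ σ i ≠ i) ∧ σ i ≠ k).card ≤
      (Finset.univ.filter fun σ : Equiv.Perm (Fin N) => σ (σ i) = k).card := by
    intro k hk
    have hk' : k ≠ i := by simpa using hk
    refine Finset.card_le_card_of_injOn (fun σ => Equiv.swap i k * σ) ?_ ?_
    · intro σ hσ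
      simp only [Finset.coe_filter, Finset.mem_univ, true_and] at hσ ⊢
      obtain ⟨⟨h1, h2⟩, h3⟩ := hσ
      change (Equiv.swap i k) (σ ((Equiv.swap i k) (σ i))) = k
      rw [Equiv.swap_apply_of_ne_of_ne h2 h3, h1, Equiv.swap_apply_left]
    · intro σ _ σ' _ h
      exact mul_left_cancel h
  have h2 := Finset.sum_le_sum h1
  have h3 : ∑ k ∈ Finset.univ.erase i,
      (Finset.univ.filter fun σ : Equiv.Perm (Fin N) => σ (σ i) = k).card ≤ N.factorial := by
    have h2 := Finset.card_eq_sum_card_fiberwise (s := (Finset.univ : Finset (Equiv.Perm (Fin N))))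
      (t := Finset.univ) (f := fun σ => σ (σ i)) (fun _ _ => by simp)
    rw [Finset.card_univ, Fintype.card_perm, Fintype.card_fin] at h2
    rw [h2]
    exact Finset.sum_le_sum_of_subset (Finset.erase_subset _ _)
  refine le_trans ?_ (h2.trans h3)
  simp only [Finset.card_filter]
  rw [Finset.sum_comm, Finset.mul_sum]
  refine Finset.sum_le_sum fun σ _ => ?_
  by_cases hσ : σ (σ i) = i ∧ σ i ≠ i
  · simp only [hσ, true_and, ne_eq, not_false_eq_true, if_true, mul_one, and_self]
    rw [← Finset.card_filter]
    have : (Finset.univ.erase i).erase (σ i) ⊆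
        (Finset.univ.erase i).filter fun k => ¬ σ i = k := by
      intro k hk
      simp only [Finset.mem_erase, Finset.mem_univ, and_true, Finset.mem_filter] at hk ⊢
      exact ⟨hk.2, fun h => hk.1 h.symm⟩
    refine le_trans ?_ (Finset.card_le_card this)
    rw [Finset.card_erase_of_mem (by simp [hσ.2]), Finset.card_erase_of_mem (by simp)]
    simp
    omega
  · simp [hσ]

lemma avg_trace {N : ℕ} (hN : 1 ≤ N) :
    (1 / (N.factorial : ℝ)) * ∑ σ : Equiv.Perm (Fin N), (σ.permMatrix ℝ).trace = 1 := by
  simp only [trace_perm_eq]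
  rw [Finset.sum_comm]
  have h : ∀ i : Fin N, ∑ σ : Equiv.Perm (Fin N), (if σ i = i then (1 : ℝ) else 0) =
      N.factorial / N := by
    intro i
    rw [Finset.sum_boole, eq_div_iff (by positivity), mul_comm]
    exact_mod_cast card_fix i
  simp only [h]
  have : (N.factorial : ℝ) ≠ 0 := by positivity
  have : (N : ℝ) ≠ 0 := by positivity
  simp
  field_simp

lemma avg_trace_sq {N : ℕ} (hN : 4 ≤ N) :
    (1 / (N.factorial : ℝ)) * ∑ σ : Equiv.Perm (Fin N),
      (σ.permMatrix ℝ * σ.permMatrix ℝ).trace ≤ 3 := by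
  simp only [trace_perm_sq_eq]
  rw [Finset.sum_comm]
  have hN4 : (4 : ℝ) ≤ N := by exact_mod_cast hN
  have h : ∀ i : Fin N, ∑ σ : Equiv.Perm (Fin N), (if σ (σ i) = i then (1 : ℝ) else 0) ≤
      3 * N.factorial / N := by
    intro i
    have e : ∑ σ : Equiv.Perm (Fin N), (if σ (σ i) = i then (1 : ℝ) else 0) ≤
       ∑ σ : Equiv.Perm (Fin N), ((if σ i = i then (1 : ℝ) else 0) +
        (if σ (σ i) = i ∧ σ i ≠ i then (1 : ℝ) else 0)) := by
      refine Finset.sum_le_sum fun σ _ => ?_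
      by_cases h1 : σ i = i
      · simp [h1]
      · simp [h1]
    refine e.trans ?_
    rw [Finset.sum_add_distrib, Finset.sum_boole, Finset.sum_boole, le_div_iff₀ (by linarith)]
    have q1 : (N : ℝ) * (Finset.univ.filter fun σ : Equiv.Perm (Fin N) => σ i = i).card =
      N.factorial := by exact_mod_cast card_fix i
    have q2 : ((N : ℝ) - 2) *
      (Finset.univ.filter fun σ : Equiv.Perm (Fin N) => σ (σ i) = i ∧ σ i ≠ i).card ≤
      N.factorial := by
      have := card_fix_sq i
      have h2 : ((N - 2 : ℕ) : ℝ) = (N : ℝ) - 2 := by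
        rw [Nat.cast_sub (by omega)]; simp
      rw [← h2]
      exact_mod_cast this
    set x : ℝ := ((Finset.univ.filter fun σ : Equiv.Perm (Fin N) => σ i = i).card : ℝ)
    set y : ℝ := ((Finset.univ.filter
      fun σ : Equiv.Perm (Fin N) => σ (σ i) = i ∧ σ i ≠ i).card : ℝ)
    have hy : 0 ≤ y := by positivity
    nlinarith
  have hf : (0 : ℝ) < N.factorial := by positivity
  calc _ ≤ (1 / (N.factorial : ℝ)) * ∑ i : Fin N, 3 * (N.factorial : ℝ) / N := by
        gcongr with i _
        exact h i
    _ = 3 := by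
        have : (N : ℝ) ≠ 0 := by linarith
        simp
        field_simp

lemma trace_perm_nonneg {N : ℕ} (σ : Equiv.Perm (Fin N)) : 0 ≤ (σ.permMatrix ℝ).trace := by
  rw [trace_perm_eq]
  exact Finset.sum_nonneg fun i _ => by split_ifs <;> norm_num

lemma trace_perm_sq_nonneg {N : ℕ} (σ : Equiv.Perm (Fin N)) :
    0 ≤ (σ.permMatrix ℝ * σ.permMatrix ℝ).trace := by
  rw [trace_perm_sq_eq]
  exact Finset.sum_nonneg fun i _ => by split_ifs <;> norm_num

/-- the law of a scaled entry, for a fixed permutation -/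
noncomputable def entryLaw {N : ℕ} (μ : Measure (Matrix (Fin N) (Fin N) ℝ)) (a b : Fin N)
    (σ : Equiv.Perm (Fin N)) : Measure ℝ :=
  μ.map (fun M => √(N : ℝ) * ((M * σ.permMatrix ℝ * Mᵀ) a b))

/-- the mixture law -/
noncomputable def mixLaw {N : ℕ} (μ : Measure (Matrix (Fin N) (Fin N) ℝ)) (a b : Fin N) :
    Measure ℝ := ((N.factorial : ENNReal)⁻¹) • ∑ σ : Equiv.Perm (Fin N), entryLaw μ a b σ

lemma continuous_conjP {N : ℕ} (P : Matrix (Fin N) (Fin N) ℝ) :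
    Continuous (fun M : Matrix (Fin N) (Fin N) ℝ => M * P * Mᵀ) :=
  (continuous_id.matrix_mul continuous_const).matrix_mul continuous_id.matrix_transpose

lemma continuous_scaled {N : ℕ} (a b : Fin N) (P : Matrix (Fin N) (Fin N) ℝ) :
    Continuous (fun M : Matrix (Fin N) (Fin N) ℝ => √(N : ℝ) * ((M * P * Mᵀ) a b)) :=
  continuous_const.mul ((continuous_conjP P).matrix_elem a b)

lemma entryLaw_prob {N : ℕ} {μ : Measure (Matrix (Fin N) (Fin N) ℝ)} (hμ : IsHaarOrthogonal N μ)
    (a b : Fin N) (σ : Equiv.Perm (Fin N)) : IsProbabilityMeasure (entryLaw μ a b σ) := by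
  have := hμ.isProb
  exact Measure.isProbabilityMeasure_map (continuous_scaled a b _).measurable.aemeasurable

lemma mixLaw_prob {N : ℕ} {μ : Measure (Matrix (Fin N) (Fin N) ℝ)} (hμ : IsHaarOrthogonal N μ)
    (a b : Fin N) : IsProbabilityMeasure (mixLaw μ a b) := by
  have := entryLaw_prob hμ a b
  constructor
  simp [mixLaw, Fintype.card_perm]
  exact ENNReal.inv_mul_cancel (by exact_mod_cast N.factorial_ne_zero) (ENNReal.natCast_ne_top _)

lemma mixLaw_Iic {N : ℕ} {μ : Measure (Matrix (Fin N) (Fin N) ℝ)} (hμ : IsHaarOrthogonal N μ)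
    (a b : Fin N) (x : ℝ) : (mixLaw μ a b (Set.Iic x)).toReal =
    (1 / (N.factorial : ℝ)) * ∑ σ : Equiv.Perm (Fin N),
      (μ {M | √(N : ℝ) * ((M * σ.permMatrix ℝ * Mᵀ) a b) ≤ x}).toReal := by
  have := entryLaw_prob hμ a b
  simp only [mixLaw, Measure.smul_apply, Measure.coe_finsetSum, Finset.sum_apply, smul_eq_mul,
    ENNReal.toReal_mul, ENNReal.toReal_inv, ENNReal.toReal_natCast, one_div]
  rw [ENNReal.toReal_sum (fun σ _ => measure_ne_top _ _)]
  congr 1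
  refine Finset.sum_congr rfl fun σ _ => ?_
  rw [entryLaw, Measure.map_apply (continuous_scaled a b _).measurable measurableSet_Iic]
  rfl

lemma mixLaw_charFun {N : ℕ} {μ : Measure (Matrix (Fin N) (Fin N) ℝ)} (hμ : IsHaarOrthogonal N μ)
    (a b : Fin N) (t : ℝ) : charFun (mixLaw μ a b) t =
    ((1 / (N.factorial : ℝ) : ℝ) : ℂ) * ∑ σ : Equiv.Perm (Fin N),
      ∫ A, eC √(N : ℝ) t (A a b) ∂(μ.map (fun M => M * σ.permMatrix ℝ * Mᵀ)) := by
  have := entryLaw_prob hμ a b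
  have := hμ.isProb
  have hc : Continuous (fun x : ℝ => Complex.exp (t * x * Complex.I)) := by fun_prop
  rw [charFun_apply_real, mixLaw, integral_smul_measure, integral_finsetSum_measure]
  · rw [Complex.real_smul]
    congr 1
    · simp
    refine Finset.sum_congr rfl fun σ _ => ?_
    rw [entryLaw, integral_map (continuous_scaled a b _).measurable.aemeasurable
      hc.aestronglyMeasurable, integral_map (continuous_conjP _).measurable.aemeasurable]
    · congr 1
      funext M
      unfold eC
      push_cast
      congr 1
      ring
    · have := continuous_entryC a b
      have : Continuous (fun A : Matrix (Fin N) (Fin N) ℝ => eC √(N : ℝ) t (A a b)) := by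
        unfold eC
        fun_prop
      exact this.aestronglyMeasurable
  · intro σ _
    refine Integrable.of_bound hc.aestronglyMeasurable 1 (Filter.Eventually.of_forall fun x => ?_)
    rw [show (t : ℂ) * x * Complex.I = ((t * x : ℝ) : ℂ) * Complex.I by push_cast; ring,
      Complex.norm_exp_ofReal_mul_I]

lemma mixLaw_bound {N : ℕ} {μ : Measure (Matrix (Fin N) (Fin N) ℝ)} (hμ : IsHaarOrthogonal N μ)
    (hN : 4 ≤ N) (a b : Fin N) (t : ℝ) :
    ‖charFun (mixLaw μ a b) t - Complex.exp (-(t : ℂ) ^ 2 / 2)‖ ≤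
      (1 + |t|) * |t| * (18 / √(N : ℝ)) := by
  have hf : (0 : ℝ) < N.factorial := by positivity
  have e : charFun (mixLaw μ a b) t - Complex.exp (-(t : ℂ) ^ 2 / 2) =
      ((1 / (N.factorial : ℝ) : ℝ) : ℂ) * ∑ σ : Equiv.Perm (Fin N),
      ((∫ A, eC √(N : ℝ) t (A a b) ∂(μ.map (fun M => M * σ.permMatrix ℝ * Mᵀ))) -
        Complex.exp (-(t : ℂ) ^ 2 / 2)) := by
    rw [mixLaw_charFun hμ, Finset.sum_sub_distrib, mul_sub]
    congr 1
    have : (N.factorial : ℂ) ≠ 0 := by exact_mod_cast N.factorial_ne_zero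
    simp [Fintype.card_perm]
    field_simp
  rw [e, norm_mul, Complex.norm_real, Real.norm_of_nonneg (by positivity)]
  calc _ ≤ (1 / (N.factorial : ℝ)) * ∑ σ : Equiv.Perm (Fin N), (1 + |t|) * |t| *
        ((3 * (σ.permMatrix ℝ).trace + (σ.permMatrix ℝ * σ.permMatrix ℝ).trace + 12) /
          √(N : ℝ)) := by
        gcongr
        refine (norm_sum_le _ _).trans (Finset.sum_le_sum fun σ _ => ?_)
        exact (haar_conjInv hμ _ (perm_orth σ)).char_bound (haar_conjInv_sq hμ _ (perm_orth σ)) hN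
          (trace_perm_nonneg σ) (trace_perm_sq_nonneg σ) a b t
    _ = (1 + |t|) * |t| * ((3 * ((1 / (N.factorial : ℝ)) * ∑ σ : Equiv.Perm (Fin N),
          (σ.permMatrix ℝ).trace) + ((1 / (N.factorial : ℝ)) * ∑ σ : Equiv.Perm (Fin N),
          (σ.permMatrix ℝ * σ.permMatrix ℝ).trace) + 12) / √(N : ℝ)) := by
        rw [← Finset.mul_sum, ← Finset.sum_div, Finset.sum_add_distrib, Finset.sum_add_distrib,
          ← Finset.mul_sum, Finset.sum_const, Finset.card_univ, Fintype.card_perm,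
          Fintype.card_fin, nsmul_eq_mul]
        field_simp
    _ ≤ _ := by
        gcongr
        have h1 := avg_trace (N := N) (by omega)
        have h2 := avg_trace_sq hN
        linarith

/-- for `M` Haar on `O(n)` and `P` an independent uniform random
permutation matrix, `√n (M P Mᵀ)_{ab}` converges in distribution to a standard normal.
The law of `√n (M P Mᵀ)_{ab}` is the uniform mixture over `σ ∈ S_n`. -/
theorem stmt11 (μ : ∀ n : ℕ, Measure (Matrix (Fin (n + 1)) (Fin (n + 1)) ℝ))
    (hμ : ∀ n, IsHaarOrthogonal (n + 1) (μ n)) (a b : ∀ n : ℕ, Fin (n + 1)) (x : ℝ) :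
    Filter.Tendsto
      (fun n => (1 / (Nat.factorial (n + 1) : ℝ)) *
        ∑ σ : Equiv.Perm (Fin (n + 1)),
          ((μ n) {M | Real.sqrt (n + 1) *
            ((M * σ.permMatrix ℝ * Mᵀ) (a n) (b n)) ≤ x}).toReal)
      Filter.atTop (nhds (((gaussianReal 0 1) (Set.Iic x)).toReal)) := by
  let ρ : ℕ → ProbabilityMeasure ℝ := fun n => ⟨mixLaw (μ n) (a n) (b n), mixLaw_prob (hμ n) _ _⟩
  let γ : ProbabilityMeasure ℝ := ⟨gaussianReal 0 1, inferInstance⟩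
  have hconv : Filter.Tendsto ρ Filter.atTop (nhds γ) := by
    refine ProbabilityMeasure.tendsto_iff_tendsto_charFun.2 fun t => ?_
    have hγ : charFun (γ : Measure ℝ) t = Complex.exp (-(t : ℂ) ^ 2 / 2) := by
      change charFun (gaussianReal 0 1) t = _
      rw [charFun_gaussianReal]
      simp [neg_div]
    rw [hγ, tendsto_iff_norm_sub_tendsto_zero]
    have hlim : Filter.Tendsto (fun n : ℕ => (1 + |t|) * |t| * (18 / √((n + 1 : ℕ) : ℝ)))
        Filter.atTop (nhds 0) := by
      rw [← mul_zero ((1 + |t|) * |t|)]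
      refine Filter.Tendsto.const_mul _ (Filter.Tendsto.const_div_atTop ?_ _)
      exact Real.tendsto_sqrt_atTop.comp
        (tendsto_natCast_atTop_atTop.comp (Filter.tendsto_add_atTop_nat 1))
    refine squeeze_zero' (Filter.Eventually.of_forall fun n => norm_nonneg _) ?_ hlim
    filter_upwards [Filter.eventually_ge_atTop 3] with n hn
    exact mixLaw_bound (hμ n) (by omega) (a n) (b n) t
  have hfin := ProbabilityMeasure.tendsto_measure_of_null_frontier_of_tendsto' hconv
    (E := Set.Iic x) (by
      change gaussianReal 0 1 (frontier (Set.Iic x)) = 0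
      have : NullSingletonClass (gaussianReal 0 1) := nullSingletonClass_gaussianReal one_ne_zero
      rw [frontier_Iic]
      exact measure_singleton x)
  have hr := (ENNReal.tendsto_toReal (measure_ne_top (gaussianReal 0 1) (Set.Iic x))).comp hfin
  refine hr.congr fun n => ?_
  have := mixLaw_Iic (hμ n) (a n) (b n) x
  push_cast at this
  exact this
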